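/- Let W be the Coxeter group of affine type D̃_{n+2} and w ∈ FC(W) star irreducible with full support (supp(w) = S). If w is not a complete zigzag, then, writing w = u_0⋯u_m in Cartier–Foata normal form, m ≥ 1 and f_•(w) = f_∘(w) = 0. -/

import Mathlib

open CoxeterSystem

namespace CoxFC


open CoxeterSystem


variable {B : Type*} {W : Type*} [Group W] {M : CoxeterMatrix B}

/-- One commutation move: swap two adjacent commuting letters. -/
def CommStep (M : CoxeterMatrix B) (l l' : List B) : Prop :=
  ∃ (l₁ l₂ : List B) (a b : B), M a b = 2 ∧
    l = l₁ ++ a :: b :: l₂ ∧ l' = l₁ ++ b :: a :: l₂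

/-- Two words are commutation equivalent if related by a sequence of commutation moves. -/
def CommEquiv (M : CoxeterMatrix B) : List B → List B → Prop :=
  Relation.ReflTransGen (CommStep M)

/-- A fully commutative element: any two reduced expressions are commutation equivalent. -/
def IsFC (cs : CoxeterSystem M W) (w : W) : Prop :=
  ∀ l l' : List B, cs.IsReduced l → cs.IsReduced l' →
    cs.wordProd l = w → cs.wordProd l' = w → CommEquiv M l l'

/-- `m s t ≥ 3`, where a matrix entry `0` denotes `∞`. -/
def Big (M : CoxeterMatrix B) (s t : B) : Prop := 3 ≤ M s t ∨ M s t = 0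

/-- `w` is left star reducible by `s` with respect to `t`. -/
def IsLeftStarReducible (cs : CoxeterSystem M W) (s t : B) (w : W) : Prop :=
  Big M s t ∧ cs.IsLeftDescent w s ∧ cs.IsLeftDescent (cs.simple s * w) t

/-- `w` is right star reducible by `s` with respect to `t`. -/
def IsRightStarReducible (cs : CoxeterSystem M W) (s t : B) (w : W) : Prop :=
  Big M s t ∧ cs.IsRightDescent w s ∧ cs.IsRightDescent (w * cs.simple s) t

/-- A single left star reduction step from `w` to `v`. -/
def LeftStarStep (cs : CoxeterSystem M W) (w v : W) : Prop :=
  ∃ s t : B, IsLeftStarReducible cs s t w ∧ v = cs.simple s * w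

/-- A single (left or right) star reduction step from `w` to `v`. -/
def StarStep (cs : CoxeterSystem M W) (w v : W) : Prop :=
  ∃ s t : B, (IsLeftStarReducible cs s t w ∧ v = cs.simple s * w) ∨
    (IsRightStarReducible cs s t w ∧ v = w * cs.simple s)

/-- `w` admits no left star reduction. -/
def LeftStarIrreducible (cs : CoxeterSystem M W) (w : W) : Prop :=
  ∀ s t : B, ¬ IsLeftStarReducible cs s t w

/-- `w` admits no star reduction at all. -/
def StarIrreducible (cs : CoxeterSystem M W) (w : W) : Prop :=
  ∀ s t : B, ¬ IsLeftStarReducible cs s t w ∧ ¬ IsRightStarReducible cs s t w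

/-- A product of pairwise commuting generators (including the identity). -/
def IsCC (cs : CoxeterSystem M W) (w : W) : Prop :=
  ∃ l : List B, cs.IsReduced l ∧ cs.wordProd l = w ∧
    ∀ a ∈ l, ∀ b ∈ l, a ≠ b → M a b = 2

/-- The support of `w`: generators appearing in some reduced expression. -/
def Supp (cs : CoxeterSystem M W) (w : W) : Set B :=
  {a | ∃ l : List B, cs.IsReduced l ∧ cs.wordProd l = w ∧ a ∈ l}

/-- `us` is the Cartier–Foata normal form of `w`, presented as a list of words,
each a product of pairwise commuting generators. -/
def IsCFNF (cs : CoxeterSystem M W) (w : W) (us : List (List B)) : Prop :=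
  (∀ l ∈ us, l ≠ []) ∧
  cs.wordProd us.flatten = w ∧
  cs.IsReduced us.flatten ∧
  (∀ l ∈ us, ∀ a ∈ l, ∀ b ∈ l, a ≠ b → M a b = 2) ∧
  (∀ a : B, (∃ l ∈ us.head?, a ∈ l) ↔ cs.IsLeftDescent w a) ∧
  (∀ j : ℕ, j + 1 < us.length → ∀ t ∈ us.getD (j+1) [],
      ∃ s ∈ us.getD j [], Big M s t)



/-- One orientation of the edges of the Coxeter graph of type D̃_{n+2}. -/
def DHalf (n a b : ℕ) : Prop :=
  (a = 0 ∧ b = 2) ∨ (a = 1 ∧ b = 2) ∨ (2 ≤ a ∧ a ≤ n ∧ b = a + 1) ∨ (a = n ∧ b = n + 2)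

/-- Adjacency (bond of order 3) in the Coxeter graph of type D̃_{n+2}:
`s_0, s_1` are joined to `s_2`, `s_2 — s_3 — ⋯ — s_n` is a path, and
`s_{n+1}, s_{n+2}` are joined to `s_n`. -/
def DAdj (n a b : ℕ) : Prop := DHalf n a b ∨ DHalf n b a

instance (n a b : ℕ) : Decidable (DAdj n a b) := by unfold DAdj DHalf; infer_instance

lemma dAdj_symm (n a b : ℕ) : DAdj n a b ↔ DAdj n b a := or_comm

lemma dHalf_ne (n a b : ℕ) (h : DHalf n a b) : a ≠ b := by unfold DHalf at h; omega

lemma dAdj_ne (n a b : ℕ) (h : DAdj n a b) : a ≠ b := by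
  rcases h with h | h
  · exact dHalf_ne n a b h
  · exact (dHalf_ne n b a h).symm

/-- The Coxeter matrix of affine type D̃_{n+2}, with vertices `s_0, …, s_{n+2}`. -/
def DMatrix (n : ℕ) : CoxeterMatrix (Fin (n+3)) where
  M := Matrix.of fun i j : Fin (n+3) ↦
    if DAdj n i j then 3 else if i = j then 1 else 2
  isSymm := by
    apply Matrix.IsSymm.ext
    intro i j
    simp only [Matrix.of_apply]
    by_cases h : DAdj n (i : ℕ) (j : ℕ)
    · rw [if_pos h, if_pos ((dAdj_symm n (i : ℕ) (j : ℕ)).mp h)]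
    · rw [if_neg h, if_neg (fun hh => h ((dAdj_symm n (j : ℕ) (i : ℕ)).mp hh))]
      by_cases h2 : (j : Fin (n+3)) = i
      · simp [h2]
      · rw [if_neg h2, if_neg (fun hh => h2 hh.symm)]
  diagonal i := by
    have : ¬ DAdj n (i : ℕ) (i : ℕ) := fun h => dAdj_ne n i i h rfl
    simp [this]
  off_diagonal i j h := by
    have h2 : (i : Fin (n+3)) ≠ j := h
    by_cases hA : DAdj n (i : ℕ) (j : ℕ) <;> simp [Matrix.of_apply, hA, h2]

/-- The generator `s_k` of type D̃_{n+2}, for `k ≤ n+2`. -/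
def dv (n k : ℕ) : Fin (n+3) := ⟨k % (n+3), Nat.mod_lt _ (Nat.succ_pos _)⟩



variable {n : ℕ} {W : Type*} [Group W]

/-- The generators `{s_3, s_5, …, s_{n-1}}` (odd indices from 3 to n-1). -/
def OddCore (n : ℕ) : Set (Fin (n+3)) :=
  {a | 3 ≤ (a : ℕ) ∧ (a : ℕ) ≤ n - 1 ∧ (a : ℕ) % 2 = 1}

/-- The generators `{s_2, s_4, …, s_n}` (even indices from 2 to n). -/
def EvenCore (n : ℕ) : Set (Fin (n+3)) :=
  {a | 2 ≤ (a : ℕ) ∧ (a : ℕ) ≤ n ∧ (a : ℕ) % 2 = 0}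

/-- A candy element of type D̃_{n+2} (for n even): an FC element whose
Cartier–Foata normal form `u_0 ⋯ u_m` has `m ≥ 2` even,
`supp(u_{2i}) = {s_3, s_5, …, s_{n-1}} ∪ {x_i, y_i}` with `x_i ∈ {s_0, s_1}`,
`y_i ∈ {s_{n+1}, s_{n+2}}`, `x_i ≠ x_{i+1}`, `y_i ≠ y_{i+1}`, and
`supp(u_{2i+1}) = {s_2, s_4, …, s_n}`. -/
def IsCandy (cs : CoxeterSystem (DMatrix n) W) (w : W) : Prop :=
  ∃ (us : List (List (Fin (n+3)))) (m : ℕ) (x y : ℕ → Fin (n+3)),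
    IsCFNF cs w us ∧ us.length = m + 1 ∧ 2 ≤ m ∧ m % 2 = 0 ∧
    (∀ i : ℕ, 2*i ≤ m →
      ((x i : ℕ) = 0 ∨ (x i : ℕ) = 1) ∧ ((y i : ℕ) = n+1 ∨ (y i : ℕ) = n+2) ∧
      {a | a ∈ us.getD (2*i) []} = OddCore n ∪ {x i, y i}) ∧
    (∀ i : ℕ, 2*(i+1) ≤ m → x i ≠ x (i+1) ∧ y i ≠ y (i+1)) ∧
    (∀ i : ℕ, 2*i+1 ≤ m → {a | a ∈ us.getD (2*i+1) []} = EvenCore n)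

/-- The word `A = s_2 s_3 ⋯ s_n s_{n+1} s_{n+2}`. -/
def AWord (n : ℕ) : List (Fin (n+3)) := (List.range' 2 (n+1)).map (dv n)

/-- The word `B = s_n s_{n-1} ⋯ s_2 s_1 s_0`. -/
def BWord (n : ℕ) : List (Fin (n+3)) := ((List.range (n+1)).reverse).map (dv n)

/-- The word `s_0 s_1 (AB)^k A^h`. -/
def ZigWord1 (n k h : ℕ) : List (Fin (n+3)) :=
  [dv n 0, dv n 1] ++ (List.replicate k (AWord n ++ BWord n)).flatten ++
    (List.replicate h (AWord n)).flatten

/-- The word `s_{n+2} s_{n+1} (BA)^k B^h`. -/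
def ZigWord2 (n k h : ℕ) : List (Fin (n+3)) :=
  [dv n (n+2), dv n (n+1)] ++ (List.replicate k (BWord n ++ AWord n)).flatten ++
    (List.replicate h (BWord n)).flatten

/-- A complete zigzag: an element admitting a reduced expression
`s_0 s_1 (AB)^k A^h` or `s_{n+2} s_{n+1} (BA)^k B^h`, `k ≥ 0`, `h ∈ {0,1}`, `k+h > 0`. -/
def IsCompleteZigzag (cs : CoxeterSystem (DMatrix n) W) (w : W) : Prop :=
  ∃ k h : ℕ, h ≤ 1 ∧ 0 < k + h ∧
    ((cs.IsReduced (ZigWord1 n k h) ∧ cs.wordProd (ZigWord1 n k h) = w) ∨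
     (cs.IsReduced (ZigWord2 n k h) ∧ cs.wordProd (ZigWord2 n k h) = w))

/-- A weak zigzag: a factor of a complete zigzag that is not a product of
pairwise commuting generators. -/
def IsWeakZigzag (cs : CoxeterSystem (DMatrix n) W) (w : W) : Prop :=
  (∃ z x y : W, IsCompleteZigzag cs z ∧ z = x * w * y ∧
      cs.length z = cs.length x + cs.length w + cs.length y) ∧ ¬ IsCC cs w

/-- The number of occurrences of the (contiguous) factor `a b` in the word `l`. -/
def CountFactor {n : ℕ} (a b : Fin (n+3)) (l : List (Fin (n+3))) : ℕ :=
  (List.range (l.length - 1)).countP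
    (fun i => (l.getD i a == a) && (l.getD (i+1) b == b))

/-- `f_•(w)`: the maximal number of occurrences of the factor `s_0 s_1` over all
reduced expressions of `w`. -/
noncomputable def fBullet (cs : CoxeterSystem (DMatrix n) W) (w : W) : ℕ :=
  sSup {c | ∃ l, cs.IsReduced l ∧ cs.wordProd l = w ∧
    CountFactor (dv n 0) (dv n 1) l = c}

/-- `f_∘(w)`: the maximal number of occurrences of the factor `s_{n+1} s_{n+2}`
over all reduced expressions of `w`. -/
noncomputable def fCirc (cs : CoxeterSystem (DMatrix n) W) (w : W) : ℕ :=
  sSup {c | ∃ l, cs.IsReduced l ∧ cs.wordProd l = w ∧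
    CountFactor (dv n (n+1)) (dv n (n+2)) l = c}



/-- The combinatorial properties of the set of reduced words (letters in `ℕ`) of a
star irreducible fully commutative element with full support. -/
structure Sys (n : ℕ) (P : List ℕ → Prop) : Prop where
  le : ∀ l, P l → ∀ x ∈ l, x ≤ n + 2
  swap : ∀ l₁ a b l₂, P (l₁ ++ a :: b :: l₂) → a ≠ b → ¬ DAdj n a b → P (l₁ ++ b :: a :: l₂)
  ss : ∀ l₁ s l₂, ¬ P (l₁ ++ s :: s :: l₂)
  sds : ∀ l₁ s d l₂, DAdj n s d → ¬ P (l₁ ++ s :: d :: s :: l₂)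
  right : ∀ l s t, DAdj n s t → ¬ P (l ++ [s, t])
  left : ∀ l s t, DAdj n s t → ¬ P (s :: t :: l)
  len : ∀ l l', P l → P l' → l.length = l'.length
  supp : ∀ l, P l → ∀ x ≤ n + 2, x ∈ l

/-- Two distinct letters that commute. -/
def Cm (n a b : ℕ) : Prop := a ≠ b ∧ ¬ DAdj n a b

lemma Cm.symm {n a b : ℕ} (h : Cm n a b) : Cm n b a :=
  ⟨h.1.symm, fun h' => h.2 ((dAdj_symm n b a).mp h')⟩

section combi

variable {n : ℕ} {P : List ℕ → Prop}

lemma Sys.move1 (S : Sys n P) (a : ℕ) (m : List ℕ) : ∀ (l₁ l₂ : List ℕ),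
    P (l₁ ++ a :: (m ++ l₂)) → (∀ x ∈ m, Cm n a x) → P (l₁ ++ m ++ a :: l₂) := by
  induction m with
  | nil => intro l₁ l₂ h _; simpa using h
  | cons b m ih =>
    intro l₁ l₂ h hm
    have hb := hm b (by simp)
    have h1 := S.swap l₁ a b (m ++ l₂) (by simpa using h) hb.1 hb.2
    have h2 := ih (l₁ ++ [b]) l₂ (by simpa using h1) (fun x hx => hm x (by simp [hx]))
    simpa using h2

lemma Sys.move1' (S : Sys n P) (a : ℕ) (m : List ℕ) : ∀ (l₁ l₂ : List ℕ),
    P (l₁ ++ m ++ a :: l₂) → (∀ x ∈ m, Cm n a x) → P (l₁ ++ a :: (m ++ l₂)) := by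
  induction m with
  | nil => intro l₁ l₂ h _; simpa using h
  | cons b m ih =>
    intro l₁ l₂ h hm
    have hb := (hm b (by simp)).symm
    have h2 := ih (l₁ ++ [b]) l₂ (by simpa using h) (fun x hx => hm x (by simp [hx]))
    have h1 := S.swap l₁ b a (m ++ l₂) (by simpa using h2) hb.1 hb.2
    simpa using h1

lemma Sys.move (S : Sys n P) (m : List ℕ) (u : List ℕ) : ∀ (l₁ l₂ : List ℕ),
    P (l₁ ++ u ++ m ++ l₂) → (∀ a ∈ u, ∀ x ∈ m, Cm n a x) → P (l₁ ++ m ++ u ++ l₂) := by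
  induction u with
  | nil => intro l₁ l₂ h _; simpa using h
  | cons a u ih =>
    intro l₁ l₂ h hm
    have h1 := ih (l₁ ++ [a]) l₂ (by simpa using h) (fun x hx => hm x (by simp [hx]))
    have h2 := S.move1 a m l₁ (u ++ l₂) (by simpa using h1) (hm a (by simp))
    simpa using h2

/-- Between two consecutive occurrences of `s` there are at least two neighbours. -/
lemma Sys.no (S : Sys n P) (l₁ l₂ m : List ℕ) (s d : ℕ) (hm : m.Nodup) (hs : s ∉ m)
    (hd : ∀ x ∈ m, DAdj n s x → x = d) : ¬ P (l₁ ++ s :: m ++ s :: l₂) := by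
  intro h
  by_cases hA : d ∈ m ∧ DAdj n s d
  · obtain ⟨hdm, hA⟩ := hA
    obtain ⟨m₁, m₂, rfl⟩ := List.append_of_mem hdm
    have e1 : ∀ x ∈ m₁, Cm n s x := by
      intro x hx
      refine ⟨fun e => hs (by simp [e, hx]), fun h' => ?_⟩
      have := hd x (by simp [hx]) h'
      subst this
      simp [List.nodup_append] at hm
      exact hm.2.2 _ hx |>.1 rfl
    have e2 : ∀ x ∈ m₂, Cm n s x := by
      intro x hx
      refine ⟨fun e => hs (by simp [e, hx]), fun h' => ?_⟩
      have := hd x (by simp [hx]) h'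
      subst this
      simp [List.nodup_append] at hm
      exact hm.2.1.1 hx
    have h1 := S.move1 s m₁ l₁ (d :: m₂ ++ s :: l₂) (by simpa using h) e1
    have h2 := S.move1' s m₂ (l₁ ++ m₁ ++ [s, d]) l₂ (by simpa using h1) e2
    exact S.sds (l₁ ++ m₁) s d (m₂ ++ l₂) hA (by simpa using h2)
  · have e1 : ∀ x ∈ m, Cm n s x := by
      intro x hx
      refine ⟨fun e => hs (by simp [e, hx]), fun h' => hA ?_⟩
      have := hd x hx h'
      subst this
      exact ⟨hx, h'⟩
    have h1 := S.move1 s m l₁ (s :: l₂) (by simpa using h) e1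
    exact S.ss (l₁ ++ m) s l₂ (by simpa using h1)

lemma range_split (c i : ℕ) (h : c ≤ i) :
    List.range (i+1) = List.range c ++ c :: List.range' (c+1) (i-c) := by
  obtain ⟨k, rfl⟩ := Nat.exists_eq_add_of_le h
  rw [add_assoc, List.range_add]
  congr 1
  rw [show c + k - c = k by omega, ← List.range'_eq_map_range, List.range'_succ]

/-- what cannot follow an ascending strand -/
lemma Sys.noF (S : Sys n P) (hn : 2 ≤ n) (p q : List ℕ) (c i : ℕ) (hc : c ≤ i) (hi : i ≤ n + 2)
    (h' : ¬ (c = n ∧ i = n + 2)) : ¬ P (p ++ List.range (i+1) ++ c :: q) := by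
  rw [range_split c i hc]
  have := S.no (p ++ List.range c) q (List.range' (c+1) (i-c)) c (if c < 2 then 2 else c+1)
    (List.nodup_range') (by simp) (by
      intro x hx h
      simp only [List.mem_range'_1] at hx
      unfold DAdj DHalf at h
      split_ifs <;> omega)
  simpa using this

/-- what cannot precede a full ascending strand -/
lemma Sys.noP (S : Sys n P) (hn : 2 ≤ n) (p q : List ℕ) (c : ℕ) (hc : c ≤ n + 2) (h2 : c ≠ 2) :
    ¬ P (p ++ c :: List.range (n+3) ++ q) := by
  rw [range_split c (n+2) hc]
  have := S.no p (List.range' (c+1) (n+2-c) ++ q) (List.range c) c (min (c-1) n)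
    (List.nodup_range) (by simp) (by
      intro x hx h
      simp only [List.mem_range] at hx
      unfold DAdj DHalf at h
      omega)
  simpa using this

lemma adj_pred {n i : ℕ} (h2 : 2 ≤ i) (hi : i ≤ n) : DAdj n (i-1) i := by
  unfold DAdj DHalf; omega

lemma adj_last {n : ℕ} (hn : 2 ≤ n) : DAdj n n (n+1) ∧ DAdj n n (n+2) := by
  unfold DAdj DHalf; omega

lemma Sys.step (S : Sys n P) (hn : 2 ≤ n) (p q : List ℕ) (i : ℕ) (h2 : 2 ≤ i) (hi : i + 1 ≤ n)
    (h : P (p ++ List.range (i+1) ++ q)) :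
    ∃ q₁ q₂, P (p ++ q₁ ++ List.range (i+2) ++ q₂) ∧ ∀ x ∈ q₁, 4 ≤ x := by
  have hq : q.takeWhile (fun x => decide (i + 1 < x)) ++ q.dropWhile (fun x => decide (i+1 < x)) = q :=
    List.takeWhile_append_dropWhile
  have hq1 : ∀ x ∈ q.takeWhile (fun x => decide (i + 1 < x)), i + 1 < x := by
    intro x hx
    simpa using List.mem_takeWhile_imp hx
  have hr : ∀ c r, q.dropWhile (fun x => decide (i+1 < x)) = c :: r → ¬ (i + 1 < c) := by
    intro c r hcr
    have := List.head?_dropWhile_not (fun x => decide (i+1 < x)) q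
    rw [hcr] at this
    simpa using this
  generalize q.takeWhile (fun x => decide (i + 1 < x)) = q₁ at *
  generalize q.dropWhile (fun x => decide (i + 1 < x)) = r at *
  subst hq
  have h1 := S.move q₁ (List.range (i+1)) p r (by simpa using h) (by
    intro a ha x hx
    have := hq1 x hx
    simp only [List.mem_range] at ha
    unfold Cm DAdj DHalf
    omega)
  cases r with
  | nil =>
    exfalso
    refine S.right (p ++ q₁ ++ List.range (i-1)) (i-1) i (adj_pred h2 (by omega)) ?_
    have e : List.range (i+1) = List.range (i-1) ++ [i-1, i] := by
      obtain ⟨j, rfl⟩ : ∃ j, i = j + 1 := ⟨i-1, by omega⟩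
      simp [List.range_succ]
    rw [e] at h1
    simpa using h1
  | cons c r =>
    have hc := hr c r rfl
    by_cases hc' : c = i + 1
    · refine ⟨q₁, r, ?_, fun x hx => by have := hq1 x hx; omega⟩
      rw [List.range_succ (n := i+1)]
      subst hc'
      simpa using h1
    · exact absurd h1 (S.noF hn _ _ c i (by omega) (by omega) (by omega))

lemma Sys.up1 (S : Sys n P) (hn : 2 ≤ n) (p q : List ℕ) (h : P (p ++ List.range 3 ++ q)) (j : ℕ) :
    j + 2 ≤ n → ∃ q₁ q₂, P (p ++ q₁ ++ List.range (j+3) ++ q₂) ∧ ∀ x ∈ q₁, 4 ≤ x := by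
  induction j with
  | zero => intro _; exact ⟨[], q, by simpa using h, by simp⟩
  | succ j ih =>
    intro hj
    obtain ⟨q₁, q₂, h1, h2⟩ := ih (by omega)
    obtain ⟨q₃, q₄, h3, h4⟩ := S.step hn (p ++ q₁) q₂ (j+2) (by omega) (by omega) h1
    refine ⟨q₁ ++ q₃, q₄, by simpa using h3, ?_⟩
    intro x hx
    rcases List.mem_append.mp hx with hx | hx
    · exact h2 x hx
    · exact h4 x hx

lemma Sys.last (S : Sys n P) (hn : 2 ≤ n) (p q : List ℕ) (h : P (p ++ List.range (n+1) ++ q)) :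
    ∃ q', P (p ++ List.range (n+3) ++ q') := by
  have e1 : List.range (n+3) = List.range n ++ [n, n+1, n+2] := by simp [List.range_succ]
  have e2 : List.range (n+2) = List.range n ++ [n, n+1] := by simp [List.range_succ]
  have e3 : List.range (n+1) = List.range n ++ [n] := by simp [List.range_succ]
  cases q with
  | nil =>
    exfalso
    have e : List.range (n+1) = List.range (n-1) ++ [n-1, n] := by
      obtain ⟨j, rfl⟩ : ∃ j, n = j + 1 := ⟨n-1, by omega⟩
      simp [List.range_succ]
    rw [e] at h
    exact S.right (p ++ List.range (n-1)) (n-1) n (adj_pred hn le_rfl) (by simpa using h)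
  | cons c q =>
    have hc : c ≤ n + 2 := S.le _ h c (by simp)
    by_cases hc0 : c ≤ n
    · exact absurd h (S.noF hn _ _ c n hc0 (by omega) (by omega))
    by_cases hc1 : c = n + 1
    · subst hc1
      have h : P (p ++ List.range (n+2) ++ q) := by rw [e2]; rw [e3] at h; simpa using h
      cases q with
      | nil =>
        rw [e2] at h
        exact absurd (by simpa using h) (S.right (p ++ List.range n) n (n+1) (adj_last hn).1)
      | cons c' q =>
        have hc' : c' ≤ n + 2 := S.le _ h c' (by simp)
        by_cases hc2 : c' ≤ n + 1
        · exact absurd h (S.noF hn _ _ c' (n+1) hc2 (by omega) (by omega))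
        · obtain rfl : c' = n + 2 := by omega
          refine ⟨q, ?_⟩
          rw [e1]; rw [e2] at h; simpa using h
    · obtain rfl : c = n + 2 := by omega
      cases q with
      | nil =>
        rw [e3] at h
        exact absurd (by simpa using h) (S.right (p ++ List.range n) n (n+2) (adj_last hn).2)
      | cons c' q =>
        have hc' : c' ≤ n + 2 := S.le _ h c' (by simp)
        by_cases hc2 : c' = n + 1
        · subst hc2
          refine ⟨q, ?_⟩
          have := S.swap (p ++ List.range (n+1)) (n+2) (n+1) q (by simpa using h) (by omega)
            (by unfold DAdj DHalf; omega)
          rw [e1]; rw [e3] at this; simpa using this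
        · by_cases hc3 : c' = n + 2
          · subst hc3
            exact absurd (by simpa using h) (S.ss (p ++ List.range (n+1)) (n+2) q)
          · exfalso
            rw [range_split c' n (by omega)] at h
            refine S.no (p ++ List.range c') q (List.range' (c'+1) (n-c') ++ [n+2]) c'
              (if c' < 2 then 2 else if c' < n then c'+1 else n + 2) ?_ ?_ ?_ (by simpa using h)
            · rw [List.nodup_append]
              refine ⟨List.nodup_range', by simp, ?_⟩
              intro a ha b hb
              simp only [List.mem_range'_1, List.mem_singleton] at ha hb
              omega
            · simp only [List.mem_append, List.mem_range'_1, List.mem_singleton]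
              omega
            · intro x hx hA
              simp only [List.mem_append, List.mem_range'_1, List.mem_singleton] at hx
              unfold DAdj DHalf at hA
              split_ifs <;> omega

/-- The ascending pass. -/
lemma Sys.up (S : Sys n P) (hn : 2 ≤ n) (p q : List ℕ) (h : P (p ++ [0, 1, 2] ++ q)) :
    ∃ q', P (p ++ List.range (n+3) ++ q') ∧ (p = [] ∨ ∃ p₀, p = p₀ ++ [2]) ∧
      (q' = [] ∨ ∃ q₀, q' = n :: q₀) := by
  obtain ⟨p₁, q₁, h1, hp₁⟩ := S.up1 hn p q h (n-2) (by omega)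
  rw [show n - 2 + 3 = n + 1 by omega] at h1
  obtain ⟨q₂, h2⟩ := S.last hn _ _ h1
  have key : ∀ r, P (r ++ List.range (n+3) ++ q₂) → r = [] ∨ ∃ p₀, r = p₀ ++ [2] := by
    intro r hr
    rcases List.eq_nil_or_concat r with rfl | ⟨r₀, c, rfl⟩
    · exact Or.inl rfl
    · right
      by_cases hc : c = 2
      · exact ⟨r₀, by simp [hc]⟩
      · exact absurd (by simpa using hr) (S.noP hn r₀ q₂ c (S.le _ hr c (by simp)) hc)
  have hp : p₁ = [] := by
    rcases List.eq_nil_or_concat p₁ with rfl | ⟨r₀, c, rfl⟩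
    · rfl
    · exfalso
      have hc := hp₁ c (by simp)
      rcases key _ h2 with h | ⟨p₀, h⟩
      · simp at h
      · simp [← List.append_assoc] at h
        omega
  subst hp
  rw [List.append_nil] at h2
  refine ⟨q₂, h2, key _ h2, ?_⟩
  cases q₂ with
  | nil => exact Or.inl rfl
  | cons c q =>
    right
    by_cases hc : c = n
    · exact ⟨q, by rw [hc]⟩
    · exact absurd h2 (S.noF hn _ _ c (n+2) (S.le _ h2 c (by simp)) le_rfl (by omega))

lemma dAdj_mirror (hn : 2 ≤ n) {a b : ℕ} (ha : a ≤ n + 2) (hb : b ≤ n + 2) :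
    DAdj n (n+2-a) (n+2-b) ↔ DAdj n a b := by
  have key : ∀ a b, a ≤ n + 2 → b ≤ n + 2 → (DHalf n a b → DHalf n (n+2-b) (n+2-a)) := by
    intro a b ha hb h
    unfold DHalf at *
    omega
  have ea : n + 2 - (n + 2 - a) = a := by omega
  have eb : n + 2 - (n + 2 - b) = b := by omega
  constructor
  · rintro (h | h)
    · have := key _ _ (by omega) (by omega) h
      rw [ea, eb] at this; exact Or.inr this
    · have := key _ _ (by omega) (by omega) h
      rw [ea, eb] at this; exact Or.inl this
  · rintro (h | h)
    · exact Or.inr (key _ _ ha hb h)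
    · exact Or.inl (key _ _ hb ha h)

/-- Image of the system under the diagram automorphism `i ↦ n + 2 - i`. -/
def Mir (n : ℕ) (P : List ℕ → Prop) (l : List ℕ) : Prop :=
  (∀ x ∈ l, x ≤ n + 2) ∧ P (l.map (fun x => n + 2 - x))

lemma Sys.mir (S : Sys n P) (hn : 2 ≤ n) : Sys n (Mir n P) where
  le l h := h.1
  swap l₁ a b l₂ h hab hA := by
    have ha := h.1 a (by simp)
    have hb := h.1 b (by simp)
    refine ⟨fun x hx => h.1 x (by simp at hx ⊢; tauto), ?_⟩
    have := S.swap (l₁.map (fun x => n + 2 - x)) (n+2-a) (n+2-b) (l₂.map (fun x => n + 2 - x))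
      (by simpa using h.2) (by omega) (by rwa [dAdj_mirror hn ha hb])
    simpa using this
  ss l₁ s l₂ h := S.ss _ _ _ (by simpa using h.2)
  sds l₁ s d l₂ hA h := by
    have ha := h.1 s (by simp)
    have hb := h.1 d (by simp)
    exact S.sds _ _ _ _ ((dAdj_mirror hn ha hb).2 hA) (by simpa using h.2)
  right l s t hA h := by
    have ha := h.1 s (by simp)
    have hb := h.1 t (by simp)
    exact S.right (l.map (fun x => n + 2 - x)) _ _ ((dAdj_mirror hn ha hb).2 hA) (by simpa using h.2)
  left l s t hA h := by
    have ha := h.1 s (by simp)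
    have hb := h.1 t (by simp)
    exact S.left (l.map (fun x => n + 2 - x)) _ _ ((dAdj_mirror hn ha hb).2 hA) (by simpa using h.2)
  len l l' h h' := by simpa using S.len _ _ h.2 h'.2
  supp l h x hx := by
    have := S.supp _ h.2 (n+2-x) (by omega)
    simp only [List.mem_map] at this
    obtain ⟨y, hy, e⟩ := this
    have := h.1 y hy
    obtain rfl : x = y := by omega
    exact hy

lemma map_mir_mir (n : ℕ) (l : List ℕ) (h : ∀ x ∈ l, x ≤ n + 2) :
    (l.map (fun x => n + 2 - x)).map (fun x => n + 2 - x) = l := by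
  rw [List.map_map]
  conv_rhs => rw [← List.map_id l]
  apply List.map_congr_left
  intro x hx
  have := h x hx
  simp; omega

lemma Sys.toMir (S : Sys n P) (l : List ℕ) (h : P l) :
    Mir n P (l.map (fun x => n + 2 - x)) := by
  refine ⟨by simp, ?_⟩
  rw [map_mir_mir n l (S.le l h)]
  exact h

lemma map_mir_range (n : ℕ) :
    (List.range (n+3)).map (fun x => n + 2 - x) = (List.range (n+3)).reverse := by
  apply List.ext_getElem
  · simp
  · intro i h1 h2
    simp

lemma Sys.rev (S : Sys n P) : Sys n (fun l => P l.reverse) where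
  le l h x hx := S.le _ h x (by simpa using hx)
  swap l₁ a b l₂ h hab hA := by
    have := S.swap l₂.reverse b a l₁.reverse (by simpa using h) hab.symm
      (by rwa [dAdj_symm])
    simpa using this
  ss l₁ s l₂ h := S.ss l₂.reverse s l₁.reverse (by simpa using h)
  sds l₁ s d l₂ hA h := S.sds l₂.reverse s d l₁.reverse hA (by simpa using h)
  right l s t hA h := S.left l.reverse t s ((dAdj_symm _ _ _).1 hA) (by simpa using h)
  left l s t hA h := S.right l.reverse t s ((dAdj_symm _ _ _).1 hA) (by simpa using h)
  len l l' h h' := by simpa using S.len _ _ h h'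
  supp l h x hx := by simpa using S.supp _ h x hx

lemma Sys.mirUp (S : Sys n P) (hn : 2 ≤ n) (p q : List ℕ) (h : P (p ++ [n+2, n+1, n] ++ q)) :
    ∃ q', P (p ++ (List.range (n+3)).reverse ++ q') ∧ (q' = [] ∨ ∃ q₀, q' = 2 :: q₀) := by
  have hp : ∀ x ∈ p, x ≤ n + 2 := fun x hx => S.le _ h x (by simp [hx])
  have h1 := S.toMir _ h
  obtain ⟨q', h2, -, h3⟩ := (S.mir hn).up hn (p.map (fun x => n + 2 - x))
    (q.map (fun x => n + 2 - x)) (by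
      simp only [List.map_append, List.map_cons, List.map_nil] at h1
      convert h1 using 5 <;> simp)
  refine ⟨q'.map (fun x => n + 2 - x), ?_, ?_⟩
  · have := h2.2
    rw [List.map_append, List.map_append, map_mir_mir n p hp, map_mir_range] at this
    exact this
  · rcases h3 with rfl | ⟨q₀, rfl⟩
    · exact Or.inl rfl
    · right; exact ⟨q₀.map (fun x => n + 2 - x), by simp⟩

lemma Sys.revUp (S : Sys n P) (hn : 2 ≤ n) (p q : List ℕ) (h : P (q ++ [2, 1, 0] ++ p)) :
    ∃ q', P (q' ++ (List.range (n+3)).reverse ++ p) := by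
  obtain ⟨q', h1, -⟩ := S.rev.up hn p.reverse q.reverse (by simpa using h)
  exact ⟨q'.reverse, by simpa using h1⟩

lemma rev_range (n : ℕ) : (List.range (n+3)).reverse =
    [n+2, n+1, n] ++ (List.range n).reverse := by
  simp [List.range_succ]

lemma range_low (n : ℕ) : List.range (n+3) = [0, 1, 2] ++ List.range' 3 n := by
  rw [range_split 2 (n+2) (by omega)]
  simp [List.range_succ]

/-- Conclusion of the leftward pass. -/
def Start (n : ℕ) (P : List ℕ → Prop) : Prop :=
  ∃ q, P (List.range (n+3) ++ q) ∨ P ((List.range (n+3)).reverse ++ q)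

lemma Start.mir (h : Start n (Mir n P)) : Start n P := by
  obtain ⟨q, h | h⟩ := h
  · have := h.2
    rw [List.map_append, map_mir_range] at this
    exact ⟨_, Or.inr this⟩
  · have := h.2
    rw [List.map_append, List.map_reverse, map_mir_range, List.reverse_reverse] at this
    exact ⟨_, Or.inl this⟩

lemma Sys.leftward (hn : 2 ≤ n) (m : ℕ) : ∀ (P : List ℕ → Prop), Sys n P → ∀ p q : List ℕ,
    p.length = m → P (p ++ [0, 1, 2] ++ q) → Start n P := by
  induction m using Nat.strong_induction_on with
  | _ m ih =>
  intro P S p q hm h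
  obtain ⟨q', h1, hp, -⟩ := S.up hn p q h
  rcases hp with rfl | ⟨p₀, rfl⟩
  · exact ⟨q', Or.inl (by simpa using h1)⟩
  · rw [range_low] at h1
    have h2 := S.swap (p₀ ++ [2]) 0 1 (2 :: (List.range' 3 n ++ q')) (by simpa using h1) (by omega)
      (by unfold DAdj DHalf; omega)
    obtain ⟨q'', h3⟩ := S.revUp hn (2 :: (List.range' 3 n ++ q')) p₀ (by simpa using h2)
    have hl := S.len _ _ h1 h3
    have h4 := S.toMir _ h3
    rw [List.map_append, List.map_append, List.map_reverse, map_mir_range, List.reverse_reverse,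
      range_low, ← List.append_assoc, List.append_assoc] at h4
    apply Start.mir
    refine ih q''.length ?_ (Mir n P) (S.mir hn) _ _ ?_ h4
    · simp at hl hm; omega
    · simp

/-- Alternating concatenation. -/
def alt : ℕ → List ℕ → List ℕ → List ℕ
  | 0, _, _ => []
  | k+1, A, B => A ++ alt k B A

/-- The word `A` in `ℕ`. -/
def An (n : ℕ) : List ℕ := List.range' 2 (n+1)
/-- The word `B` in `ℕ`. -/
def Bn (n : ℕ) : List ℕ := (List.range (n+1)).reverse

lemma range_An (n : ℕ) : List.range (n+3) = [0, 1] ++ An n := by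
  rw [range_split 1 (n+2) (by omega)]
  simp [List.range_succ, An]

lemma rev_Bn (n : ℕ) : (List.range (n+3)).reverse = [n+2, n+1] ++ Bn n := by
  simp [List.range_succ, Bn]

lemma mir_An (n : ℕ) : (An n).map (fun x => n + 2 - x) = Bn n := by
  have := map_mir_range n
  rw [rev_Bn, range_An] at this
  simpa using this

lemma mir_Bn (n : ℕ) : (Bn n).map (fun x => n + 2 - x) = An n := by
  rw [← mir_An, map_mir_mir]
  intro x hx
  simp [An] at hx
  omega

lemma mir_alt (n k : ℕ) : (alt k (An n) (Bn n)).map (fun x => n + 2 - x) = alt k (Bn n) (An n) ∧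
    (alt k (Bn n) (An n)).map (fun x => n + 2 - x) = alt k (An n) (Bn n) := by
  induction k with
  | zero => simp [alt]
  | succ k ih => simp only [alt, List.map_append, ih, mir_An, mir_Bn, and_self]

lemma An_last (hn : 2 ≤ n) : An n = List.range' 2 (n-1) ++ [n+1, n+2] := by
  obtain ⟨k, rfl⟩ : ∃ k, n = k + 1 := ⟨n-1, by omega⟩
  rw [An, show k + 1 + 1 = k + 2 by rfl, ← List.range'_append_1 (n := 2)]
  simp [List.range'_succ]
  omega

lemma Sys.rightward (hn : 2 ≤ n) (m : ℕ) : ∀ (P : List ℕ → Prop), Sys n P → ∀ z q : List ℕ,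
    q.length = m → P (z ++ List.range (n+3) ++ q) →
      ∃ k, P (z ++ [0, 1] ++ alt (k+1) (An n) (Bn n)) := by
  induction m using Nat.strong_induction_on with
  | _ m ih =>
  intro P S z q hm h
  obtain ⟨q', h1, -, hq⟩ := S.up hn z (List.range' 3 n ++ q) (by
    rw [range_low] at h; simpa using h)
  have hl := S.len _ _ h h1
  rcases hq with rfl | ⟨q₀, rfl⟩
  · refine ⟨0, ?_⟩
    simp only [alt]
    rw [range_An] at h1
    simpa using h1
  · rw [range_An, An_last hn] at h1
    have h2 := S.swap (z ++ [0, 1] ++ List.range' 2 (n-1)) (n+1) (n+2) (n :: q₀)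
      (by simpa using h1) (by omega) (by unfold DAdj DHalf; omega)
    obtain ⟨q'', h3, -⟩ := S.mirUp hn (z ++ [0, 1] ++ List.range' 2 (n-1)) q₀ (by simpa using h2)
    have hl2 := S.len _ _ h1 h3
    have hz : ∀ x ∈ z ++ [0, 1] ++ List.range' 2 (n-1), x ≤ n + 2 :=
      fun x hx => S.le _ h3 x (List.mem_append_left _ (List.mem_append_left _ hx))
    have h4 := S.toMir _ h3
    rw [List.map_append, List.map_append (l₁ := z ++ [0, 1] ++ List.range' 2 (n-1)) (l₂ := List.reverse _),
      List.map_reverse, map_mir_range, List.reverse_reverse] at h4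
    obtain ⟨k, h5⟩ := ih q''.length (by simp at hl hl2; omega) (Mir n P) (S.mir hn) _ _
      (by simp) h4
    refine ⟨k+1, ?_⟩
    have h6 := h5.2
    rw [List.map_append, List.map_append (l₁ := List.map _ _) (l₂ := [0, 1]), map_mir_mir n _ hz, (mir_alt n _).1] at h6
    have h7 := S.swap (z ++ [0, 1] ++ List.range' 2 (n-1)) (n+2) (n+1) (alt (k+1) (Bn n) (An n))
      (by simpa using h6) (by omega) (by unfold DAdj DHalf; omega)
    rw [alt, An_last hn]
    rw [An_last hn] at h7
    simpa using h7

/-- `P` contains a complete zigzag word. -/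
def Zig (n : ℕ) (P : List ℕ → Prop) : Prop :=
  ∃ k, P ([0, 1] ++ alt (k+1) (An n) (Bn n)) ∨ P ([n+2, n+1] ++ alt (k+1) (Bn n) (An n))

lemma Zig.mir (h : Zig n (Mir n P)) : Zig n P := by
  obtain ⟨k, h | h⟩ := h
  · refine ⟨k, Or.inr ?_⟩
    have := h.2
    rw [List.map_append, (mir_alt n _).1] at this
    simpa using this
  · refine ⟨k, Or.inl ?_⟩
    have := h.2
    rw [List.map_append, (mir_alt n _).2] at this
    simpa using this

lemma Sys.zig_of_start (S : Sys n P) (hn : 2 ≤ n) (h : Start n P) : Zig n P := by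
  obtain ⟨q, h | h⟩ := h
  · obtain ⟨k, h⟩ := Sys.rightward hn _ P S [] q rfl (by simpa using h)
    exact ⟨k, Or.inl (by simpa using h)⟩
  · have h := S.toMir _ h
    rw [List.map_append, List.map_reverse, map_mir_range, List.reverse_reverse] at h
    obtain ⟨k, h⟩ := Sys.rightward hn _ _ (S.mir hn) [] _ rfl (by simpa using h)
    exact Zig.mir ⟨k, Or.inl (by simpa using h)⟩

lemma Sys.push (S : Sys n P) (hn : 2 ≤ n) (m : List ℕ) : ∀ l₁ l₂ : List ℕ, 2 ∉ m →
    P (l₁ ++ [0, 1] ++ m ++ l₂) → P (l₁ ++ m ++ [0, 1] ++ l₂) := by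
  induction m with
  | nil => intro l₁ l₂ _ h; simpa using h
  | cons c m ih =>
    intro l₁ l₂ h2 h
    simp only [List.mem_cons, not_or] at h2
    by_cases h1 : c = 1
    · subst h1
      exact absurd (by simpa using h) (S.ss (l₁ ++ [0]) 1 (m ++ l₂))
    have h3 := S.swap (l₁ ++ [0]) 1 c (m ++ l₂) (by simpa using h) (by omega)
      (by unfold DAdj DHalf; omega)
    by_cases h0 : c = 0
    · subst h0
      exact absurd (by simpa using h3) (S.ss l₁ 0 (1 :: (m ++ l₂)))
    have h4 := S.swap l₁ 0 c (1 :: (m ++ l₂)) (by simpa using h3) (by omega)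
      (by unfold DAdj DHalf; omega)
    have := ih (l₁ ++ [c]) l₂ h2.2 (by simpa using h4)
    simpa using this

lemma split_first (l : List ℕ) (h : 2 ∈ l) : ∃ m r, l = m ++ 2 :: r ∧ 2 ∉ m := by
  obtain ⟨m, r, e, h'⟩ := List.eq_append_cons_of_mem h
  exact ⟨m, r, e, h'⟩

lemma Sys.main (S : Sys n P) (hn : 2 ≤ n) (l₁ l₂ : List ℕ) (h : P (l₁ ++ [0, 1] ++ l₂)) :
    Zig n P := by
  apply S.zig_of_start hn
  have h2 := S.supp _ h 2 (by omega)
  have h2 : 2 ∈ l₂ ∨ 2 ∈ l₁ := by simp at h2; tauto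
  rcases h2 with h2 | h2
  · obtain ⟨m, r, rfl, hm⟩ := split_first _ h2
    have := S.push hn m l₁ (2 :: r) hm (by simpa using h)
    exact Sys.leftward hn _ P S (l₁ ++ m) r rfl (by simpa using this)
  · obtain ⟨m, r, e, hm⟩ := split_first l₁.reverse (by simpa using h2)
    have e' : l₁ = r.reverse ++ 2 :: m.reverse := by
      rw [← List.reverse_reverse l₁, e]; simp
    subst e'
    have h' := S.swap (r.reverse ++ 2 :: m.reverse) 0 1 l₂ (by simpa using h) (by omega)
      (by unfold DAdj DHalf; omega)
    have := S.rev.push hn m l₂.reverse (2 :: r) hm (by simpa using h')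
    obtain ⟨q', h3⟩ := S.revUp hn (m.reverse ++ l₂) r.reverse (by simpa using this)
    have h4 := S.toMir _ h3
    rw [List.map_append, List.map_append, List.map_reverse, map_mir_range, List.reverse_reverse,
      range_low, ← List.append_assoc, List.append_assoc] at h4
    exact Start.mir (Sys.leftward hn _ _ (S.mir hn) _ _ rfl h4)

lemma Sys.main' (S : Sys n P) (hn : 2 ≤ n) (l₁ l₂ : List ℕ) (h : P (l₁ ++ [n+1, n+2] ++ l₂)) :
    Zig n P := by
  have h := S.swap l₁ (n+1) (n+2) l₂ (by simpa using h) (by omega) (by unfold DAdj DHalf; omega)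
  have h := S.toMir _ h
  simp only [List.map_append, List.map_cons] at h
  refine Zig.mir ((S.mir hn).main hn (l₁.map (fun x => n + 2 - x)) (l₂.map (fun x => n + 2 - x)) ?_)
  rw [show n + 2 - (n + 2) = 0 by omega, show n + 2 - (n + 1) = 1 by omega] at h
  simpa using h

lemma alt_even (A B : List ℕ) (k : ℕ) : alt (2*k) A B = (List.replicate k (A ++ B)).flatten := by
  induction k with
  | zero => rfl
  | succ k ih =>
    rw [show 2*(k+1) = 2*k+1+1 by ring, alt, alt, ih]
    simp [List.replicate_succ]

lemma alt_odd (A B : List ℕ) (k : ℕ) :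
    alt (2*k+1) A B = (List.replicate k (A ++ B)).flatten ++ A := by
  induction k with
  | zero => simp [alt]
  | succ k ih =>
    rw [show 2*(k+1)+1 = (2*k+1)+1+1 by ring, alt, alt, ih]
    simp [List.replicate_succ]

lemma alt_form (k : ℕ) : ∃ k' h, h ≤ 1 ∧ 0 < k' + h ∧
    ∀ A B, alt (k+1) A B = (List.replicate k' (A ++ B)).flatten ++ (List.replicate h A).flatten := by
  rcases Nat.even_or_odd' (k+1) with ⟨c, hc | hc⟩
  · exact ⟨c, 0, by omega, by omega, fun A B => by rw [hc, alt_even]; simp⟩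
  · exact ⟨c, 1, by omega, by omega, fun A B => by rw [hc, alt_odd]; simp⟩

end combi

section concrete

variable {n : ℕ} {W : Type*} [Group W]

lemma dv_val {k : ℕ} (hk : k ≤ n + 2) : ((dv n k : Fin (n+3)) : ℕ) = k := by
  simp only [dv]; exact Nat.mod_eq_of_lt (by omega)

lemma dv_of_val (a : Fin (n+3)) : dv n (a : ℕ) = a :=
  Fin.ext (dv_val (by omega))

lemma dM_adj {a b : ℕ} (ha : a ≤ n + 2) (hb : b ≤ n + 2) (h : DAdj n a b) :
    DMatrix n (dv n a) (dv n b) = 3 := by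
  change (if DAdj n (dv n a : ℕ) (dv n b : ℕ) then 3 else _) = 3
  rw [dv_val ha, dv_val hb, if_pos h]

lemma dM_comm {a b : ℕ} (ha : a ≤ n + 2) (hb : b ≤ n + 2) (hab : a ≠ b) (h : ¬ DAdj n a b) :
    DMatrix n (dv n a) (dv n b) = 2 := by
  change (if DAdj n (dv n a : ℕ) (dv n b : ℕ) then 3 else if dv n a = dv n b then 1 else 2) = 2
  have h' : dv n a ≠ dv n b := fun e => hab (by rw [← dv_val ha, ← dv_val hb, e])
  rw [dv_val ha, dv_val hb, if_neg h, if_neg h']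

lemma CommEquiv.perm {B : Type*} {M : CoxeterMatrix B} {l l' : List B} (h : CommEquiv M l l') :
    l.Perm l' := by
  induction h with
  | refl => exact List.Perm.refl _
  | tail _ h ih =>
    obtain ⟨l₁, l₂, a, b, -, rfl, rfl⟩ := h
    exact ih.trans (List.Perm.append_left _ (List.Perm.swap _ _ _))

/-- Reduced words of `w`, with letters in `ℕ`. -/
def RW (cs : CoxeterSystem (DMatrix n) W) (w : W) (l : List ℕ) : Prop :=
  (∀ x ∈ l, x ≤ n + 2) ∧ cs.IsReduced (l.map (dv n)) ∧ cs.wordProd (l.map (dv n)) = w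

lemma RW.of_prod {cs : CoxeterSystem (DMatrix n) W} {w : W} {l l' : List ℕ} (h : RW cs w l)
    (hm : ∀ x ∈ l', x ≤ n + 2) (hl : l'.length = l.length)
    (hp : cs.wordProd (l'.map (dv n)) = cs.wordProd (l.map (dv n))) : RW cs w l' := by
  refine ⟨hm, ?_, hp.trans h.2.2⟩
  have := h.2.1
  unfold CoxeterSystem.IsReduced at *
  rw [hp, this]
  simp [hl]

lemma RW.of_fin {cs : CoxeterSystem (DMatrix n) W} {w : W} {l : List (Fin (n+3))}
    (h1 : cs.IsReduced l) (h2 : cs.wordProd l = w) : RW cs w (l.map Fin.val) := by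
  have e : (l.map Fin.val).map (dv n) = l := by
    rw [List.map_map]
    conv_rhs => rw [← List.map_id l]
    exact List.map_congr_left (fun a _ => dv_of_val a)
  refine ⟨?_, by rwa [e], by rwa [e]⟩
  intro x hx
  simp only [List.mem_map] at hx
  obtain ⟨a, -, rfl⟩ := hx
  omega

lemma mem_of_fc {cs : CoxeterSystem (DMatrix n) W} {w : W} (hw : IsFC cs w)
    (hsupp : Supp cs w = Set.univ) {l : List (Fin (n+3))}
    (h1 : cs.IsReduced l) (h2 : cs.wordProd l = w) (a : Fin (n+3)) : a ∈ l := by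
  have : a ∈ Supp cs w := by rw [hsupp]; trivial
  obtain ⟨l', h3, h4, h5⟩ := this
  exact ((hw l' l h3 h1 h4 h2).perm.mem_iff).1 h5

lemma len_pair (cs : CoxeterSystem (DMatrix n) W) (u : List (Fin (n+3))) (s t : Fin (n+3))
    (h : cs.IsReduced (u ++ [t, s])) :
    cs.IsRightDescent (cs.wordProd (u ++ [t, s])) s ∧
    cs.IsRightDescent (cs.wordProd (u ++ [t, s]) * cs.simple s) t := by
  have e1 : cs.wordProd (u ++ [t, s]) * cs.simple s = cs.wordProd (u ++ [t]) := by
    simp [cs.wordProd_append, cs.wordProd_cons, mul_assoc]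
  have e2 : cs.wordProd (u ++ [t]) * cs.simple t = cs.wordProd u := by
    simp [cs.wordProd_append, mul_assoc]
  have l1 := cs.length_wordProd_le (u ++ [t])
  have l2 := cs.length_wordProd_le u
  have h0 := h
  unfold CoxeterSystem.IsReduced at h0
  have l3 := cs.length_mul_simple (cs.wordProd (u ++ [t, s])) s
  unfold CoxeterSystem.IsRightDescent
  rw [e1] at *
  rw [e2]
  simp only [List.length_append, List.length_cons, List.length_nil] at *
  omega

lemma sys_of (hn : 2 ≤ n) (cs : CoxeterSystem (DMatrix n) W) (w : W) (hw : IsFC cs w)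
    (hirr : StarIrreducible cs w) (hsupp : Supp cs w = Set.univ) : Sys n (RW cs w) where
  le l h := h.1
  swap l₁ a b l₂ h hab hA := by
    have ha := h.1 a (by simp)
    have hb := h.1 b (by simp)
    refine h.of_prod (fun x hx => h.1 x (by simp at hx ⊢; tauto)) (by simp) ?_
    have hp := cs.simple_mul_simple_pow (dv n a) (dv n b)
    rw [dM_comm ha hb hab hA, pow_two] at hp
    have hc : cs.simple (dv n b) * cs.simple (dv n a) = cs.simple (dv n a) * cs.simple (dv n b) := by
      have := eq_inv_of_mul_eq_one_left hp
      rw [mul_inv_rev, cs.inv_simple, cs.inv_simple] at this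
      exact this.symm
    simp only [List.map_append, List.map_cons, cs.wordProd_append, cs.wordProd_cons]
    rw [← mul_assoc (cs.simple (dv n b)), hc, mul_assoc]
  ss l₁ s l₂ h := by
    have h1 := h.2.1
    unfold CoxeterSystem.IsReduced at h1
    have e : cs.wordProd ((l₁ ++ s :: s :: l₂).map (dv n)) = cs.wordProd ((l₁ ++ l₂).map (dv n)) := by
      simp [cs.wordProd_append, cs.wordProd_cons]
    have h2 := cs.length_wordProd_le ((l₁ ++ l₂).map (dv n))
    rw [← e, h1] at h2
    simp at h2
  sds l₁ s d l₂ hA h := by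
    have ha := h.1 s (by simp)
    have hb := h.1 d (by simp)
    have hp := cs.simple_mul_simple_pow (dv n s) (dv n d)
    rw [dM_adj ha hb hA] at hp
    have hc : cs.simple (dv n d) * (cs.simple (dv n s) * cs.simple (dv n d)) =
        cs.simple (dv n s) * (cs.simple (dv n d) * cs.simple (dv n s)) := by
      have h3 : (cs.simple (dv n s) * (cs.simple (dv n d) * cs.simple (dv n s))) *
        (cs.simple (dv n d) * (cs.simple (dv n s) * cs.simple (dv n d))) = 1 := by
        rw [← hp]; simp only [pow_succ, pow_zero, one_mul, mul_assoc]
      have := eq_inv_of_mul_eq_one_left h3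
      simp only [mul_inv_rev, cs.inv_simple, mul_assoc] at this
      exact this.symm
    have h' : RW cs w (l₁ ++ d :: s :: d :: l₂) := by
      refine h.of_prod (fun x hx => h.1 x (by simp at hx ⊢; tauto)) (by simp) ?_
      simp only [List.map_append, List.map_cons, cs.wordProd_append, cs.wordProd_cons]
      congr 1
      have := congrArg (fun z => z * cs.wordProd (l₂.map (dv n))) hc
      simpa only [mul_assoc] using this
    have hperm := (hw _ _ h.2.1 h'.2.1 h.2.2 h'.2.2).perm
    have hne : dv n d ≠ dv n s := fun e => by
      have := dAdj_ne n s d hA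
      exact this (by rw [← dv_val ha, ← dv_val hb, e])
    have := hperm.count_eq (dv n s)
    simp [hne] at this
  right l s t hA h := by
    have ha := h.1 s (by simp)
    have hb := h.1 t (by simp)
    have h1 := h.2.1
    have h2 := h.2.2
    rw [List.map_append] at h1 h2
    obtain ⟨d1, d2⟩ := len_pair cs (l.map (dv n)) (dv n t) (dv n s) h1
    refine (hirr (dv n t) (dv n s)).2 ⟨Or.inl ?_, ?_, ?_⟩
    · rw [dM_adj hb ha ((dAdj_symm _ _ _).1 hA)]
    · rw [← h2]; exact d1
    · rw [← h2]; exact d2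
  left l s t hA h := by
    have ha := h.1 s (by simp)
    have hb := h.1 t (by simp)
    have h1 := h.2.1
    have h2 := h.2.2
    have hr := h1.reverse
    have e : ((s :: t :: l).map (dv n)).reverse = (l.map (dv n)).reverse ++ [dv n t, dv n s] := by
      simp
    have e2 : cs.wordProd ((l.map (dv n)).reverse ++ [dv n t, dv n s]) = w⁻¹ := by
      rw [← e, cs.wordProd_reverse, h2]
    rw [e] at hr
    obtain ⟨d1, d2⟩ := len_pair cs _ (dv n s) (dv n t) hr
    rw [e2] at d1 d2
    refine (hirr (dv n s) (dv n t)).1 ⟨Or.inl ?_, ?_, ?_⟩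
    · rw [dM_adj ha hb hA]
    · exact cs.isRightDescent_inv_iff.1 d1
    · rw [← cs.isRightDescent_inv_iff, mul_inv_rev, cs.inv_simple]
      exact d2
  len l l' h h' := by
    have h1 := h.2.1
    have h2 := h'.2.1
    unfold CoxeterSystem.IsReduced at h1 h2
    rw [h.2.2] at h1
    rw [h'.2.2] at h2
    simpa [h1] using h2
  supp l h x hx := by
    have := mem_of_fc hw hsupp h.2.1 h.2.2 (dv n x)
    simp only [List.mem_map] at this
    obtain ⟨y, hy, e⟩ := this
    have h1 := h.1 y hy
    have : y = x := by rw [← dv_val h1, ← dv_val hx, e]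
    rwa [← this]

lemma zig_complete {cs : CoxeterSystem (DMatrix n) W} {w : W} (h : Zig n (RW cs w)) :
    IsCompleteZigzag cs w := by
  obtain ⟨k, h⟩ := h
  obtain ⟨k', j, hj, hkj, e⟩ := alt_form k
  refine ⟨k', j, hj, hkj, ?_⟩
  have e1 : ([0, 1] ++ alt (k+1) (An n) (Bn n)).map (dv n) = ZigWord1 n k' j := by
    rw [e]; simp [ZigWord1, AWord, BWord, An, Bn, List.map_flatten]
  have e2 : ([n+2, n+1] ++ alt (k+1) (Bn n) (An n)).map (dv n) = ZigWord2 n k' j := by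
    rw [e]; simp [ZigWord2, AWord, BWord, An, Bn, List.map_flatten]
  rw [← e1, ← e2]
  rcases h with h | h
  · exact Or.inl h.2
  · exact Or.inr h.2

lemma factor_of_count (a b : Fin (n+3)) (l : List (Fin (n+3))) (h : CountFactor a b l ≠ 0) :
    ∃ l₁ l₂, l = l₁ ++ [a, b] ++ l₂ := by
  unfold CountFactor at h
  have h := Nat.pos_of_ne_zero h
  rw [List.countP_pos_iff] at h
  obtain ⟨i, hi, h⟩ := h
  simp only [List.mem_range] at hi
  have h1 : i < l.length := by omega
  have h2 : i + 1 < l.length := by omega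
  simp only [Bool.and_eq_true, beq_iff_eq, List.getD_eq_getElem _ _ h1,
    List.getD_eq_getElem _ _ h2] at h
  refine ⟨l.take i, l.drop (i+2), ?_⟩
  conv_lhs => rw [← List.take_append_drop i l, List.drop_eq_getElem_cons h1,
    List.drop_eq_getElem_cons h2, h.1, h.2]
  simp

end concrete

theorem stmt17 (n : ℕ) (hn : 2 ≤ n) {W : Type*} [Group W]
    (cs : CoxeterSystem (DMatrix n) W) (w : W) (hw : IsFC cs w)
    (hirr : StarIrreducible cs w) (hsupp : Supp cs w = Set.univ)
    (hcz : ¬ IsCompleteZigzag cs w) :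
    (∀ us : List (List (Fin (n+3))), IsCFNF cs w us → 2 ≤ us.length) ∧
    fBullet cs w = 0 ∧ fCirc cs w = 0 := by
  have S := sys_of hn cs w hw hirr hsupp
  refine ⟨?_, ?_, ?_⟩
  · rintro us ⟨-, h1, h2, h3, -⟩
    have hm := mem_of_fc hw hsupp h2 h1
    rcases us with _ | ⟨l, _ | ⟨l', us⟩⟩
    · simp at hm
    · exfalso
      simp only [List.flatten_cons, List.flatten_nil, List.append_nil] at hm
      have hA : DAdj n 0 2 := by unfold DAdj DHalf; omega
      have h4 := dM_adj (n := n) (a := 0) (b := 2) (by omega) (by omega) hA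
      have h5 := h3 l (by simp) _ (hm (dv n 0)) _ (hm (dv n 2)) (fun e => by
        have := congrArg Fin.val e
        rw [dv_val (by omega), dv_val (by omega)] at this
        omega)
      omega
    · simp
  · refine Nat.le_zero.1 (csSup_le' ?_)
    rintro c ⟨l, h1, h2, rfl⟩
    by_contra h
    obtain ⟨l₁, l₂, rfl⟩ := factor_of_count _ _ _ (fun h0 => h (le_of_eq h0))
    have h3 := RW.of_fin h1 h2
    simp only [List.map_append, List.map_cons, List.map_nil] at h3
    rw [dv_val (by omega), dv_val (by omega)] at h3
    exact hcz (zig_complete (S.main hn _ _ h3))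
  · refine Nat.le_zero.1 (csSup_le' ?_)
    rintro c ⟨l, h1, h2, rfl⟩
    by_contra h
    obtain ⟨l₁, l₂, rfl⟩ := factor_of_count _ _ _ (fun h0 => h (le_of_eq h0))
    have h3 := RW.of_fin h1 h2
    simp only [List.map_append, List.map_cons, List.map_nil] at h3
    rw [dv_val (by omega), dv_val (by omega)] at h3
    exact hcz (zig_complete (S.main' hn _ _ h3))

end CoxFC
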